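/- arXiv:1809.06515 — 2 statements merged into one kernel-verified Lean document; each statement's English description precedes it below -/
import Mathlib

section
/- Let γ > 0 and let f ∈ 𝒜. Suppose I^c_{a,b} f(z) ≠ 0 for all z ∈ U with z ≠ 0, and that Re( I^c_{a+1,b} f(z) / I^c_{a,b} f(z) ) < 1 + 1/(2aγ) for all z ∈ U \ {0}. Then I^c_{a,b} f(z)/z is subordinate to (1+z)^{1/γ}, i.e. there exists an analytic function ω on U with ω(0) = 0 and |ω(z)| < 1 for all z ∈ U such that I^c_{a,b} f(z)/z = (1 + ω(z))^{1/γ} (principal branch) for all z ∈ U. -/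
open Complex Metric

/-- Pochhammer symbol `(x)_n = x (x+1) ⋯ (x+n-1)`. -/
noncomputable def poch (x : ℝ) (n : ℕ) : ℝ := (ascPochhammer ℝ n).eval x

/-- The `k`-th coefficient multiplier of the Hohlov operator `I^c_{a,b}`:
`(a)_{k-1} (b)_{k-1} / ((c)_{k-1} (k-1)!)`. -/
noncomputable def hohCoef (a b c : ℝ) (k : ℕ) : ℝ :=
  poch a (k - 1) * poch b (k - 1) / (poch c (k - 1) * (Nat.factorial (k - 1)))

/-- Membership in the class `𝒜`, described via the Taylor coefficient sequence:
`coef 0 = 0`, `coef 1 = 1`, and the power series converges on the open unit disk. -/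
def InClassA (coef : ℕ → ℂ) : Prop :=
  coef 0 = 0 ∧ coef 1 = 1 ∧
    ∀ z ∈ ball (0 : ℂ) 1, Summable fun k : ℕ => coef k * z ^ k

/-- Membership in the class `R^c_{a,b}`: `f ∈ 𝒜` and `I^c_{a,b} f(z)/z ≺ √(1+z)`,
i.e. there is a Schwarz function `ω` with
`I^c_{a,b} f(z) = z (1 + ω z)^{1/2}` (principal branch) on the unit disk. -/
def InClassR (a b c : ℝ) (coef : ℕ → ℂ) : Prop :=
  InClassA coef ∧
    ∃ ω : ℂ → ℂ, AnalyticOn ℂ ω (ball (0 : ℂ) 1) ∧ ω 0 = 0 ∧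
      (∀ z ∈ ball (0 : ℂ) 1, ‖ω z‖ < 1) ∧
      ∀ z ∈ ball (0 : ℂ) 1,
        HasSum (fun k : ℕ => (hohCoef a b c k : ℂ) * coef k * z ^ k)
          (z * (1 + ω z) ^ ((1 : ℂ) / 2))

/-- A function with zero derivative on the unit ball is constant. -/
theorem const_ball_aux {g : ℂ → ℂ} (h : ∀ z ∈ ball (0 : ℂ) 1, HasDerivAt g 0 z)
    {z : ℂ} (hz : z ∈ ball (0 : ℂ) 1) : g z = g 0 := by
  have h0 : (0 : ℂ) ∈ ball (0 : ℂ) 1 := by simp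
  have := (convex_ball (0 : ℂ) 1).norm_image_sub_le_of_norm_hasDerivWithin_le (C := 0)
    (fun x hx => (h x hx).hasDerivWithinAt) (by simp) h0 hz
  simpa [sub_eq_zero] using this

/-- The Jack lemma on boundary maxima. -/
theorem jack_aux {w : ℂ → ℂ} (hw : DifferentiableOn ℂ w (ball (0 : ℂ) 1)) (hw0 : w 0 = 0)
    {z₀ : ℂ} (hz₀ : z₀ ∈ ball (0 : ℂ) 1) (hne : z₀ ≠ 0) (h1 : ‖w z₀‖ = 1)
    (hle : ∀ z, ‖z‖ < ‖z₀‖ → ‖w z‖ ≤ 1) :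
    ∃ k : ℝ, 1 ≤ k ∧ z₀ * deriv w z₀ = k * w z₀ := by
  have hr : 0 < ‖z₀‖ := norm_pos_iff.2 hne
  have hw1 : w z₀ ≠ 0 := by
    intro h; simp [h] at h1
  have hz1 : ‖z₀‖ < 1 := by simpa using hz₀
  have schw : ∀ z, ‖z‖ < ‖z₀‖ → ‖w z‖ ≤ 1 / ‖z₀‖ * ‖z‖ := by
    intro z hz
    have := Complex.dist_le_div_mul_dist_of_mapsTo_ball (f := w) (c := 0) (R₁ := ‖z₀‖) (R₂ := 1)
      (z := z) (hw.mono (ball_subset_ball hz1.le))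
      (fun y hy => by rw [hw0]; simpa using hle y (by simpa using hy)) (by simpa using hz)
    simpa [hw0] using this
  have schw' : ∀ z, ‖z‖ ≤ ‖z₀‖ → ‖w z‖ ≤ 1 / ‖z₀‖ * ‖z‖ := by
    intro z hz
    have hcl : z ∈ closure (ball (0 : ℂ) ‖z₀‖) := by
      rw [closure_ball _ hr.ne']; simpa using hz
    have hzb : z ∈ ball (0 : ℂ) 1 := by simpa using hz.trans_lt hz1
    have hc : ContinuousAt w z := hw.continuousOn.continuousAt (isOpen_ball.mem_nhds hzb)
    refine ContinuousWithinAt.closure_le hcl (f := fun z => ‖w z‖)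
      (g := fun z => 1 / ‖z₀‖ * ‖z‖) hc.norm.continuousWithinAt
      (by fun_prop) (fun y hy => schw y (by simpa using hy))
  set lam := z₀ * deriv w z₀ / w z₀ with hlam
  have hd : HasDerivAt w (deriv w z₀) z₀ :=
    (hw.differentiableAt (isOpen_ball.mem_nhds hz₀)).hasDerivAt
  let v : ℂ → ℂ := fun ζ => w (z₀ * exp ζ) / w z₀ * exp (-ζ)
  have hv : HasDerivAt v (lam - 1) 0 := by
    have e1 : HasDerivAt (fun ζ : ℂ => z₀ * exp ζ) z₀ 0 := by
      simpa using (Complex.hasDerivAt_exp 0).const_mul z₀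
    have e2 : HasDerivAt (fun ζ : ℂ => exp (-ζ)) (-1) 0 := by
      simpa using (hasDerivAt_neg (0 : ℂ)).cexp
    have hd' : HasDerivAt w (deriv w z₀) (z₀ * exp 0) := by simpa using hd
    have e3 := ((hd'.comp (0 : ℂ) e1).div_const (w z₀)).mul e2
    refine e3.congr_deriv ?_
    simp [hlam, hw1]
    ring
  have hvle : ∀ ζ : ℂ, ζ.re ≤ 0 → (v ζ).re ≤ 1 := by
    intro ζ hζ
    refine (Complex.re_le_norm _).trans ?_
    have hn : ‖z₀ * exp ζ‖ = ‖z₀‖ * Real.exp ζ.re := by simp [Complex.norm_exp]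
    have h2 := schw' (z₀ * exp ζ) (by
      rw [hn]; exact mul_le_of_le_one_right hr.le (by simpa using hζ))
    rw [hn] at h2
    have h3 : 1 / ‖z₀‖ * (‖z₀‖ * Real.exp ζ.re) = Real.exp ζ.re := by field_simp
    rw [h3] at h2
    calc ‖v ζ‖ = ‖w (z₀ * exp ζ)‖ * Real.exp (-ζ.re) := by simp [v, h1, Complex.norm_exp]
      _ ≤ Real.exp ζ.re * Real.exp (-ζ.re) := by gcongr
      _ = 1 := by rw [← Real.exp_add]; simp
  have hv0 : v 0 = 1 := by simp [v, hw1]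
  let S : Set ℂ := {ζ | ζ.re ≤ 0}
  have hmax : IsLocalMaxOn (fun ζ => (v ζ).re) S 0 := by
    have : IsMaxOn (fun ζ => (v ζ).re) S 0 := by
      intro ζ hζ
      simpa [hv0] using hvle ζ hζ
    exact this.localize
  have hfd : HasFDerivWithinAt (fun ζ => (v ζ).re)
      (Complex.reCLM.comp ((ContinuousLinearMap.toSpanSingleton ℂ (lam - 1)).restrictScalars ℝ)) S 0 :=
    (Complex.reCLM.hasFDerivAt.comp (0 : ℂ)
      (hv.hasFDerivAt.restrictScalars ℝ)).hasFDerivWithinAt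
  have key : ∀ d : ℂ, d.re ≤ 0 → (d * (lam - 1)).re ≤ 0 := by
    intro d hdre
    have hcone : d ∈ posTangentConeAt S 0 := by
      apply mem_posTangentConeAt_of_segment_subset
      have hS : Convex ℝ S := convex_halfSpace_re_le 0
      exact hS.segment_subset (by simp [S]) (by simpa [S] using hdre)
    have := hmax.hasFDerivWithinAt_nonpos hfd hcone
    simpa using this
  have k1 := key (-1) (by simp)
  have k2 := key I (by simp)
  have k3 := key (-I) (by simp)
  simp at k1 k2 k3
  refine ⟨lam.re, k1, ?_⟩
  have : (lam.re : ℂ) = lam := by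
    apply Complex.ext
    · simp
    · simp; linarith
  rw [this, hlam]
  field_simp

theorem core_aux (γ : ℝ) (hγ : 0 < γ) (p : ℂ → ℂ) (hp : DifferentiableOn ℂ p (ball (0 : ℂ) 1))
    (hp0 : p 0 = 1) (hpne : ∀ z ∈ ball (0 : ℂ) 1, p z ≠ 0)
    (hre : ∀ z ∈ ball (0 : ℂ) 1, z ≠ 0 → (γ * (z * deriv p z / p z)).re < 1 / 2) :
    ∃ ω : ℂ → ℂ, AnalyticOn ℂ ω (ball (0 : ℂ) 1) ∧ ω 0 = 0 ∧
      (∀ z ∈ ball (0 : ℂ) 1, ‖ω z‖ < 1) ∧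
      ∀ z ∈ ball (0 : ℂ) 1, p z = (1 + ω z) ^ ((1 : ℂ) / (γ : ℂ)) := by
  have h0 : (0 : ℂ) ∈ ball (0 : ℂ) 1 := by simp
  have hdp : ∀ z ∈ ball (0 : ℂ) 1, HasDerivAt p (deriv p z) z := fun z hz =>
    (hp.differentiableAt (isOpen_ball.mem_nhds hz)).hasDerivAt
  have hq : DifferentiableOn ℂ (fun z => deriv p z / p z) (ball (0 : ℂ) 1) :=
    (hp.deriv isOpen_ball).div hp hpne
  obtain ⟨L, hL0, hL⟩ : ∃ L : ℂ → ℂ, L 0 = 0 ∧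
      ∀ z ∈ ball (0 : ℂ) 1, HasDerivAt L (deriv p z / p z) z := by
    obtain ⟨g, hg⟩ := hq.isExactOn_ball
    exact ⟨fun z => g z - g 0, by simp, fun z hz => (hg z hz).sub_const _⟩
  have hpL : ∀ z ∈ ball (0 : ℂ) 1, p z = exp (L z) := by
    intro z hz
    have := const_ball_aux (g := fun z => p z * exp (-L z)) (fun y hy => by
      refine ((hdp y hy).mul (hL y hy).neg.cexp).congr_deriv ?_
      have := hpne y hy
      field_simp
      ring) hz
    simp only [hp0, hL0, neg_zero, exp_zero, mul_one, exp_neg] at this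
    field_simp at this
    exact this
  let ω : ℂ → ℂ := fun z => exp (γ * L z) - 1
  have hω : ∀ z ∈ ball (0 : ℂ) 1,
      HasDerivAt ω (exp (γ * L z) * (γ * (deriv p z / p z))) z := fun z hz =>
    ((hL z hz).const_mul (γ : ℂ)).cexp.sub_const 1
  have hωd : DifferentiableOn ℂ ω (ball (0 : ℂ) 1) := fun z hz =>
    (hω z hz).differentiableAt.differentiableWithinAt
  have hω0 : ω 0 = 0 := by simp [ω, hL0]
  have hlt : ∀ z ∈ ball (0 : ℂ) 1, ‖ω z‖ < 1 := by
    intro z₁ hz₁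
    by_contra! hge
    have hz₁' : ‖z₁‖ < 1 := by simpa using hz₁
    have hsub : closedBall (0 : ℂ) ‖z₁‖ ⊆ ball 0 1 := closedBall_subset_ball hz₁'
    have hcpt : IsCompact (closedBall (0 : ℂ) ‖z₁‖ ∩ (fun z => ‖ω z‖) ⁻¹' Set.Ici 1) :=
      (isCompact_closedBall _ _).of_isClosed_subset
        ((hωd.continuousOn.mono hsub).norm.preimage_isClosed_of_isClosed
          isClosed_closedBall isClosed_Ici) Set.inter_subset_left
    obtain ⟨z₀, ⟨hz₀c, hz₀1⟩, hmin⟩ := hcpt.exists_isMinOn ⟨z₁, by simp, hge⟩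
      continuous_norm.continuousOn
    have hz₀ := hsub hz₀c
    simp only [Set.mem_preimage, Set.mem_Ici] at hz₀1
    have hne : z₀ ≠ 0 := by
      rintro rfl
      simp [hω0] at hz₀1
      linarith
    have hle : ∀ z, ‖z‖ < ‖z₀‖ → ‖ω z‖ ≤ 1 := by
      intro z hz
      by_contra! hgt
      have hzc : z ∈ closedBall (0 : ℂ) ‖z₁‖ := by
        simp at hz₀c ⊢
        linarith
      have := hmin ⟨hzc, hgt.le⟩
      simp at this
      linarith
    have hle0 : ‖ω z₀‖ ≤ 1 := by
      have hcl : z₀ ∈ closure (ball (0 : ℂ) ‖z₀‖) := by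
        rw [closure_ball _ (norm_ne_zero_iff.2 hne)]; simp
      exact ContinuousWithinAt.closure_le hcl (f := fun z => ‖ω z‖) (g := fun _ => (1 : ℝ))
        (hω z₀ hz₀).continuousAt.norm.continuousWithinAt
        continuousWithinAt_const (fun y hy => hle y (by simpa using hy))
    have h1 : ‖ω z₀‖ = 1 := le_antisymm hle0 hz₀1
    obtain ⟨k, hk, hkeq⟩ := jack_aux hωd hω0 hz₀ hne h1 hle
    rw [(hω z₀ hz₀).deriv] at hkeq
    have hE : exp (γ * L z₀) = 1 + ω z₀ := by simp [ω]
    have hEne : 1 + ω z₀ ≠ 0 := by rw [← hE]; exact exp_ne_zero _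
    rw [hE] at hkeq
    have hval : (γ : ℂ) * (z₀ * deriv p z₀ / p z₀) = k * (ω z₀ / (1 + ω z₀)) := by
      rw [← mul_div_assoc (k : ℂ), ← hkeq]
      field_simp
    have h2 := hre z₀ hz₀ hne
    rw [hval, Complex.re_ofReal_mul] at h2
    have h3 : (ω z₀ / (1 + ω z₀)).re = 1 / 2 := by
      have hsq : (ω z₀).re * (ω z₀).re + (ω z₀).im * (ω z₀).im = 1 := by
        rw [← Complex.normSq_apply, Complex.normSq_eq_norm_sq, h1]; norm_num
      have hns : Complex.normSq (1 + ω z₀) ≠ 0 := by simpa [Complex.normSq_eq_zero] using hEne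
      rw [Complex.div_re, ← add_div, div_eq_iff hns, Complex.normSq_apply]
      simp
      linarith
    rw [h3] at h2
    linarith
  refine ⟨ω, (hωd.analyticOnNhd isOpen_ball).analyticOn, hω0, hlt, ?_⟩
  have hslit : ∀ z ∈ ball (0 : ℂ) 1, 1 + ω z ∈ slitPlane := fun z hz =>
    Complex.mem_slitPlane_of_norm_lt_one (hlt z hz)
  intro z hz
  have hlog : Complex.log (1 + ω z) = γ * L z := by
    have := const_ball_aux (g := fun z => Complex.log (1 + ω z) - γ * L z) (fun y hy => by
      refine ((((hω y hy).const_add 1).clog (hslit y hy)).sub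
        ((hL y hy).const_mul (γ : ℂ))).congr_deriv ?_
      have hE : exp (γ * L y) = 1 + ω y := by simp [ω]
      have hEne : 1 + ω y ≠ 0 := by rw [← hE]; exact exp_ne_zero _
      rw [hE]
      field_simp
      ring) hz
    simpa [hω0, hL0, sub_eq_zero] using this
  have hγc : (γ : ℂ) ≠ 0 := by exact_mod_cast hγ.ne'
  rw [Complex.cpow_def_of_ne_zero (Complex.slitPlane_ne_zero (hslit z hz)), hlog, hpL z hz]
  congr 1
  field_simp

theorem series_aux (A : ℕ → ℂ) (F : ℂ → ℂ) (hA0 : A 0 = 0)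
    (hF : ∀ z ∈ ball (0 : ℂ) 1, HasSum (fun k : ℕ => A k * z ^ k) (F z)) :
    ∃ p : ℂ → ℂ, DifferentiableOn ℂ p (ball (0 : ℂ) 1) ∧ p 0 = A 1 ∧
      (∀ z ∈ ball (0 : ℂ) 1, F z = z * p z) ∧
      ∀ z ∈ ball (0 : ℂ) 1,
        HasSum (fun k : ℕ => ((k : ℂ) - 1) * A k * z ^ k) (z ^ 2 * deriv p z) := by
  let f : ℕ → ℂ → ℂ := fun k z => A (k + 1) * z ^ k
  let p : ℂ → ℂ := fun z => ∑' k, f k z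
  have hshift : ∀ z ∈ ball (0 : ℂ) 1, HasSum (fun k : ℕ => A (k + 1) * z ^ (k + 1)) (F z) := by
    intro z hz
    simpa [hA0] using (hasSum_nat_add_iff' 1).2 (hF z hz)
  have hu : ∀ r : ℝ, 0 < r → r < 1 → Summable fun k => ‖A (k + 1)‖ * r ^ k := by
    intro r hr hr1
    have h := (hshift (r : ℂ) (by simpa [abs_of_pos hr] using hr1)).summable.norm.mul_right (1 / r)
    refine h.congr fun k => ?_
    simp [abs_of_pos hr, pow_succ]
    field_simp
  have hfd : ∀ (s : Set ℂ) k, DifferentiableOn ℂ (f k) s := fun s k => by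
    have : Differentiable ℂ (f k) := by fun_prop
    exact this.differentiableOn
  have hbd : ∀ r : ℝ, ∀ (k : ℕ) (w : ℂ), w ∈ ball (0 : ℂ) r → ‖f k w‖ ≤ ‖A (k + 1)‖ * r ^ k := by
    intro r k w hw
    have : ‖w‖ ≤ r := by simpa using (mem_ball_zero_iff.1 hw).le
    simp only [f, norm_mul, norm_pow]
    gcongr
  have hr : ∀ z ∈ ball (0 : ℂ) 1, ∃ r : ℝ, 0 < r ∧ r < 1 ∧ z ∈ ball (0 : ℂ) r := by
    intro z hz
    obtain ⟨r, h1, h2⟩ := exists_between (mem_ball_zero_iff.1 hz)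
    exact ⟨r, (norm_nonneg z).trans_lt h1, h2, by simpa using h1⟩
  have hsum : ∀ z ∈ ball (0 : ℂ) 1, HasSum (fun k => f k z) (p z) := by
    intro z hz
    obtain ⟨r, h1, h2, h3⟩ := hr z hz
    exact (Summable.of_norm_bounded (hu r h1 h2) (fun k => hbd r k z h3)).hasSum
  refine ⟨p, ?_, ?_, ?_, ?_⟩
  · intro z hz
    obtain ⟨r, h1, h2, h3⟩ := hr z hz
    have := differentiableOn_tsum_of_summable_norm (hu r h1 h2) (hfd _) isOpen_ball (hbd r)
    exact (this.differentiableAt (isOpen_ball.mem_nhds h3)).differentiableWithinAt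
  · have h := hasSum_single (f := fun k => f k 0) 0 (fun k hk => by simp [f, hk])
    simpa [f] using h.tsum_eq
  · intro z hz
    refine (hshift z hz).unique ?_
    refine ((hsum z hz).mul_left z).congr_fun ?_
    intro k
    simp [f]; ring
  · intro z hz
    obtain ⟨r, h1, h2, h3⟩ := hr z hz
    have h := hasSum_deriv_of_summable_norm (hu r h1 h2) (hfd _) isOpen_ball (hbd r) h3
    have h' := h.mul_left (z ^ 2)
    have : HasSum (fun k : ℕ => (((k + 1 : ℕ) : ℂ) - 1) * A (k + 1) * z ^ (k + 1))
        (z ^ 2 * deriv p z) := by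
      refine h'.congr_fun ?_
      intro k
      have : deriv (f k) z = A (k + 1) * (k * z ^ (k - 1)) := by simp [f]
      rw [this]
      cases k with
      | zero => simp
      | succ n => push_cast; simp; ring
    simpa [hA0] using (hasSum_nat_add_iff' (f := fun k : ℕ => ((k : ℂ) - 1) * A k * z ^ k) 1).1
      (by simpa [hA0] using this)

theorem hoh_aux (a b c : ℝ) (k : ℕ) :
    a * hohCoef (a + 1) b c (k + 1) = (a + k) * hohCoef a b c (k + 1) := by
  have h : a * poch (a + 1) k = (a + k) * poch a k := by
    unfold poch
    have h1 : (ascPochhammer ℝ (k + 1)).eval a = a * (ascPochhammer ℝ k).eval (a + 1) := by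
      rw [ascPochhammer_succ_left]; simp
    rw [← h1, ascPochhammer_succ_eval]; ring
  simp only [hohCoef, Nat.add_sub_cancel]
  rw [← mul_div_assoc, ← mul_assoc, h]
  ring

/-- Sufficient condition: if `Re(I^c_{a+1,b}f / I^c_{a,b}f) < 1 + 1/(2aγ)` on the
punctured unit disk, then `I^c_{a,b}f(z)/z ≺ (1+z)^{1/γ}`. Here `F` and `G` denote
the Hohlov transforms `I^c_{a,b} f` and `I^c_{a+1,b} f`, respectively. -/
theorem stmt_14 (a b c : ℝ) (hc : 0 < c) (ha : c ≤ a) (hb : c ≤ b)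
    (γ : ℝ) (hγ : 0 < γ) (coef : ℕ → ℂ) (hA : InClassA coef)
    (F G : ℂ → ℂ)
    (hF : ∀ z ∈ ball (0 : ℂ) 1,
      HasSum (fun k : ℕ => (hohCoef a b c k : ℂ) * coef k * z ^ k) (F z))
    (hG : ∀ z ∈ ball (0 : ℂ) 1,
      HasSum (fun k : ℕ => (hohCoef (a + 1) b c k : ℂ) * coef k * z ^ k) (G z))
    (hne : ∀ z ∈ ball (0 : ℂ) 1, z ≠ 0 → F z ≠ 0)
    (hre : ∀ z ∈ ball (0 : ℂ) 1, z ≠ 0 → (G z / F z).re < 1 + 1 / (2 * a * γ)) :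
    ∃ ω : ℂ → ℂ, AnalyticOn ℂ ω (ball (0 : ℂ) 1) ∧ ω 0 = 0 ∧
      (∀ z ∈ ball (0 : ℂ) 1, ‖ω z‖ < 1) ∧
      ∀ z ∈ ball (0 : ℂ) 1, F z = z * (1 + ω z) ^ ((1 : ℂ) / (γ : ℂ)) := by
  have ha0 : 0 < a := hc.trans_le ha
  obtain ⟨hc0, hc1, -⟩ := hA
  obtain ⟨p, hpd, hp0, hFp, hpder⟩ :=
    series_aux (fun k => (hohCoef a b c k : ℂ) * coef k) F (by simp [hc0]) hF
  have hp1 : p 0 = 1 := by simp [hp0, hc1, hohCoef, poch]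
  have hGF : ∀ z ∈ ball (0 : ℂ) 1, z ^ 2 * deriv p z = a * (G z - F z) := by
    intro z hz
    refine (hpder z hz).unique ?_
    refine (((hG z hz).sub (hF z hz)).mul_left (a : ℂ)).congr_fun ?_
    intro k
    cases k with
    | zero => simp [hc0]
    | succ k =>
      have h : (a : ℂ) * (hohCoef (a + 1) b c (k + 1) : ℂ)
          = (a + k) * (hohCoef a b c (k + 1) : ℂ) := by exact_mod_cast hoh_aux a b c k
      push_cast
      linear_combination (-coef (k + 1) * z ^ (k + 1)) * h
  have hpne : ∀ z ∈ ball (0 : ℂ) 1, p z ≠ 0 := by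
    intro z hz h
    by_cases hz0 : z = 0
    · rw [hz0, hp1] at h; exact one_ne_zero h
    · exact hne z hz hz0 (by rw [hFp z hz, h, mul_zero])
  obtain ⟨ω, h1, h2, h3, h4⟩ := core_aux γ hγ p hpd hp1 hpne (by
    intro z hz hz0
    have hFne := hne z hz hz0
    have e : (γ : ℂ) * (z * deriv p z / p z) = ((γ * a : ℝ) : ℂ) * (G z / F z - 1) := by
      have h5 := hGF z hz
      have hpz := hpne z hz
      have : z * deriv p z / p z = z ^ 2 * deriv p z / F z := by
        rw [hFp z hz]; field_simp
      rw [this, h5]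
      push_cast
      field_simp
    rw [e, Complex.re_ofReal_mul, Complex.sub_re, Complex.one_re]
    have h6 := hre z hz hz0
    have h7 : (G z / F z).re - 1 < 1 / (2 * a * γ) := by linarith
    calc γ * a * ((G z / F z).re - 1) < γ * a * (1 / (2 * a * γ)) := by gcongr
      _ = 1 / 2 := by field_simp)
  exact ⟨ω, h1, h2, h3, fun z hz => by rw [hFp z hz, h4 z hz]⟩
end

section
/- Let f ∈ 𝒜. Suppose I^c_{a,b} f(z) ≠ 0 for all z ∈ U with z ≠ 0, and that Re( I^c_{a+1,b} f(z) / I^c_{a,b} f(z) ) < 1 + 1/(4a) for all z ∈ U \ {0}. Then f belongs to the class R^c_{a,b}. -/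
open Complex Metric

/-- Power series on the unit disk: analytic, with termwise derivative. -/
lemma aux_ps (c : ℕ → ℂ) (p : ℂ → ℂ)
    (hp : ∀ z ∈ ball (0 : ℂ) 1, HasSum (fun k : ℕ => c k * z ^ k) (p z)) :
    DifferentiableOn ℂ p (ball 0 1) ∧
    ∀ z ∈ ball (0 : ℂ) 1, HasSum (fun k : ℕ => (k : ℂ) * (c k * z ^ k)) (z * deriv p z) := by
  have key : ∀ z ∈ ball (0 : ℂ) 1, DifferentiableAt ℂ p z ∧
      HasSum (fun k : ℕ => (k : ℂ) * (c k * z ^ k)) (z * deriv p z) := by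
    intro z hz
    have hz1 : ‖z‖ < 1 := by simpa using hz
    obtain ⟨ρ, h1, h2⟩ := exists_between hz1
    have hρ0 : 0 ≤ ρ := (norm_nonneg z).trans h1.le
    have hρ : ((ρ : ℝ) : ℂ) ∈ ball (0 : ℂ) 1 := by
      simp [abs_of_nonneg hρ0, h2]
    have hu : Summable (fun k : ℕ => ‖c k‖ * ρ ^ k) := by
      have := (hp _ hρ).summable.norm
      simpa [abs_of_nonneg hρ0] using this
    have hle : ∀ (i : ℕ) (w : ℂ), w ∈ ball (0 : ℂ) ρ → ‖c i * w ^ i‖ ≤ ‖c i‖ * ρ ^ i := by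
      intro i w hw
      have : ‖w‖ < ρ := by simpa using hw
      rw [norm_mul, norm_pow]
      gcongr
    have hzm : z ∈ ball (0 : ℂ) ρ := by simpa using h1
    have hdi : ∀ i : ℕ, DifferentiableOn ℂ (fun w : ℂ => c i * w ^ i) (ball 0 ρ) := by
      intro i; fun_prop
    have hd := Complex.differentiableOn_tsum_of_summable_norm hu hdi isOpen_ball hle
    have hs := Complex.hasSum_deriv_of_summable_norm hu hdi isOpen_ball hle hzm
    have heq : p =ᶠ[nhds z] (fun w : ℂ => ∑' i : ℕ, c i * w ^ i) := by
      filter_upwards [isOpen_ball.mem_nhds hz] with w hw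
      exact (hp w hw).tsum_eq.symm
    refine ⟨((hd z hzm).differentiableAt (isOpen_ball.mem_nhds hzm)).congr_of_eventuallyEq heq, ?_⟩
    rw [heq.deriv_eq]
    have e : (fun k : ℕ => (k : ℂ) * (c k * z ^ k))
        = fun k : ℕ => z * deriv (fun w : ℂ => c k * w ^ k) z := by
      funext k
      rcases k with _ | k
      · simp
      · rw [((hasDerivAt_pow (k + 1) z).const_mul (c (k + 1))).deriv, Nat.add_sub_cancel]; ring
    rw [e]
    exact hs.mul_left z
  exact ⟨fun z hz => (key z hz).1.differentiableWithinAt, fun z hz => (key z hz).2⟩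

/-- A function nonpositive to the right of `0`, vanishing at `0`, has nonpositive derivative. -/
lemma aux_deriv (φ : ℝ → ℝ) (d : ℝ) (h : HasDerivAt φ d 0) (h0 : φ 0 = 0)
    (ε : ℝ) (hε : 0 < ε) (hle : ∀ t, 0 < t → t < ε → φ t ≤ 0) : d ≤ 0 := by
  have h1 := (hasDerivAt_iff_tendsto_slope.mp h).mono_left
    (nhdsWithin_mono (0 : ℝ) (show Set.Ioi (0:ℝ) ⊆ {0}ᶜ from fun x hx => ne_of_gt hx))
  refine le_of_tendsto h1 ?_
  filter_upwards [Ioo_mem_nhdsGT hε] with t ht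
  rw [slope_def_field, h0]
  exact div_nonpos_of_nonpos_of_nonneg (by linarith [hle t ht.1 ht.2]) (by linarith [ht.1])

/-- Lemma of Jack (boundary derivative). -/
lemma aux_jack (ω : ℂ → ℂ) (hd : DifferentiableOn ℂ ω (ball 0 1)) (h0 : ω 0 = 0)
    (z : ℂ) (hz : z ∈ ball (0 : ℂ) 1) (hz0 : z ≠ 0) (h1 : ‖ω z‖ = 1)
    (hlt : ∀ w, ‖w‖ < ‖z‖ → ‖ω w‖ < 1) :
    ∃ k : ℝ, 1 ≤ k ∧ z * deriv ω z = k * ω z := by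
  have hz1 : ‖z‖ < 1 := by simpa using hz
  have hr : 0 < ‖z‖ := norm_pos_iff.mpr hz0
  have hsch : ∀ w, ‖w‖ < ‖z‖ → ‖ω w‖ ≤ ‖w‖ / ‖z‖ := by
    intro w hw
    have := Complex.dist_le_div_mul_dist_of_mapsTo_ball (f := ω) (c := 0) (z := w) (R₁ := ‖z‖)
      (R₂ := 1) (hd.mono (ball_subset_ball hz1.le))
      (by intro x hx; simp only [h0, mem_ball_zero_iff] at *; 
          exact (by simpa using (hlt x hx).le)) (by simpa using hw)
    simp [h0] at this
    rw [div_eq_inv_mul]; simpa using this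
  set A : ℂ := z * deriv ω z * (starRingEnd ℂ) (ω z) with hA
  have hωω : ω z * (starRingEnd ℂ) (ω z) = 1 := by
    rw [Complex.mul_conj, Complex.normSq_eq_norm_sq, h1]; simp
  have main : ∀ s : ℝ, 1 ≤ (A * (1 + s * I)).re := by
    intro s
    have hD : HasDerivAt ω (deriv ω z) z :=
      ((hd z hz).differentiableAt (isOpen_ball.mem_nhds hz)).hasDerivAt
    have hline : HasDerivAt (fun t : ℝ => z * (1 - t * (1 + s * I))) (-(z * (1 + s * I))) 0 := by
      have h := (((Complex.ofRealCLM.hasDerivAt (x := (0:ℝ))).mul_const (1 + s * I)).const_sub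
        1).const_mul z
      refine HasDerivAt.congr_deriv h ?_
      simp; ring
    have hcomp : HasDerivAt (fun t : ℝ => ω (z * (1 - t * (1 + s * I))))
        (deriv ω z * (-(z * (1 + s * I)))) 0 := by
      have hD' : HasDerivAt ω (deriv ω z) (z * (1 - ((0:ℝ):ℂ) * (1 + s * I))) := by simpa using hD
      exact hD'.comp (0:ℝ) hline
    have hre := (Complex.reCLM.hasFDerivAt.comp_hasDerivAt (0:ℝ)
      (hcomp.mul_const ((starRingEnd ℂ) (ω z))))
    have hquad : HasDerivAt (fun t : ℝ => ((1 - t)^2 + s^2*t^2 + 1)/2) (-1) 0 := by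
      have h := ((((hasDerivAt_id (0:ℝ)).const_sub 1).pow 2).add
        (((hasDerivAt_id (0:ℝ)).pow 2).const_mul (s^2))).add_const 1 |>.div_const 2
      refine HasDerivAt.congr_deriv h ?_
      norm_num
    have hfin := hre.sub hquad
    have := aux_deriv _ _ hfin (by simp [hωω, -Complex.mul_re]) (2 / (1 + s^2))
      (by positivity) (by
        intro t ht htε
        set w := z * (1 - (t:ℂ) * (1 + s * I)) with hw
        have hn : ‖1 - (t:ℂ) * (1 + s * I)‖ ^ 2 = (1-t)^2 + s^2*t^2 := by
          rw [← Complex.normSq_eq_norm_sq, Complex.normSq_apply]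
          simp; ring
        have hs : t * (1 + s^2) < 2 := by
          rwa [lt_div_iff₀ (by positivity)] at htε
        have hl : ‖1 - (t:ℂ) * (1 + s * I)‖ < 1 := by
          have : ‖1 - (t:ℂ) * (1 + s * I)‖ ^ 2 < 1 := by rw [hn]; nlinarith
          nlinarith [norm_nonneg (1 - (t:ℂ) * (1 + s * I))]
        have hwz : ‖w‖ < ‖z‖ := by
          rw [hw, norm_mul]; nlinarith
        have h2 := hsch w hwz
        have h3 : ‖w‖ / ‖z‖ = ‖1 - (t:ℂ) * (1 + s * I)‖ := by
          rw [hw, norm_mul]; field_simp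
        have h4 : (ω w * (starRingEnd ℂ) (ω z)).re ≤ ‖ω w‖ := by
          refine (Complex.re_le_norm _).trans ?_
          rw [norm_mul, Complex.norm_conj, h1, mul_one]
        show (ω w * (starRingEnd ℂ) (ω z)).re - ((1 - t)^2 + s^2*t^2 + 1)/2 ≤ 0
        rw [← hn]
        nlinarith [sq_nonneg (‖1 - (t:ℂ) * (1 + s * I)‖ - 1)])
    have e : (Complex.reCLM (deriv ω z * (-(z * (1 + s * I))) * (starRingEnd ℂ) (ω z)))
        = - (A * (1 + s * I)).re := by
      rw [← Complex.neg_re, Complex.reCLM_apply, hA]; congr 1; ring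
    rw [e] at this
    linarith
  have hm : ∀ s : ℝ, 1 ≤ A.re - s * A.im := by
    intro s
    have := main s
    simp [Complex.mul_re] at this
    linarith
  have him : A.im = 0 := by
    by_contra hne
    have := hm (A.re / A.im)
    rw [div_mul_cancel₀ _ hne] at this
    linarith
  refine ⟨A.re, by simpa using hm 0, ?_⟩
  have hAr : (A.re : ℂ) = A := by apply Complex.ext <;> simp [him]
  rw [hAr, hA, mul_assoc, mul_comm _ (ω z), hωω, mul_one]

/-- Function-theoretic core. -/
lemma aux_core (p : ℂ → ℂ) (hd : DifferentiableOn ℂ p (ball 0 1)) (h0 : p 0 = 1)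
    (hne : ∀ z ∈ ball (0 : ℂ) 1, p z ≠ 0)
    (hre : ∀ z ∈ ball (0 : ℂ) 1, z ≠ 0 → (z * deriv p z / p z).re < 1 / 4) :
    (∀ z ∈ ball (0 : ℂ) 1, ‖p z ^ 2 - 1‖ < 1) ∧
    ∀ z ∈ ball (0 : ℂ) 1, 0 < (p z).re := by
  have hωd : DifferentiableOn ℂ (fun z => p z ^ 2 - 1) (ball 0 1) := by fun_prop
  have hlt : ∀ z ∈ ball (0 : ℂ) 1, ‖p z ^ 2 - 1‖ < 1 := by
    by_contra! hcon
    obtain ⟨z1, hz1, hb⟩ := hcon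
    have hz1' : ‖z1‖ < 1 := by simpa using hz1
    have hsub : closedBall (0:ℂ) ‖z1‖ ⊆ ball 0 1 := closedBall_subset_ball hz1'
    have hcont : ContinuousOn (fun z => ‖p z ^ 2 - 1‖) (closedBall (0:ℂ) ‖z1‖) :=
      (hωd.continuousOn.mono hsub).norm
    have hcl := hcont.preimage_isClosed_of_isClosed isClosed_closedBall (isClosed_Ici (a := (1:ℝ)))
    have hK := (isCompact_closedBall (0:ℂ) ‖z1‖).of_isClosed_subset hcl Set.inter_subset_left
    obtain ⟨z, hzS, hmin⟩ := hK.exists_isMinOn ⟨z1, by simp, hb⟩ continuous_norm.continuousOn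
    have hz : z ∈ ball (0:ℂ) 1 := hsub hzS.1
    have hzb : 1 ≤ ‖p z ^ 2 - 1‖ := hzS.2
    have hzz1 : ‖z‖ ≤ ‖z1‖ := by simpa using hzS.1
    have hz0 : z ≠ 0 := by
      rintro rfl
      rw [h0] at hzb; norm_num at hzb
    have hin : ∀ w, ‖w‖ < ‖z‖ → ‖p w ^ 2 - 1‖ < 1 := by
      intro w hw
      by_contra! h
      have : ‖z‖ ≤ ‖w‖ := hmin ⟨by simpa using hw.le.trans hzz1, h⟩
      linarith
    have heq : ‖p z ^ 2 - 1‖ = 1 := by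
      refine le_antisymm ?_ hzb
      have hr : ‖z‖ ≠ 0 := norm_ne_zero_iff.mpr hz0
      have hzc : z ∈ closure (ball (0:ℂ) ‖z‖) := by rw [closure_ball _ hr]; simp
      have hc : ContinuousWithinAt (fun z => ‖p z ^ 2 - 1‖) (ball (0:ℂ) ‖z‖) z :=
        (hcont z hzS.1).mono (ball_subset_closedBall.trans (closedBall_subset_closedBall hzz1))
      have := hc.mem_closure (t := Set.Iic (1:ℝ)) hzc (fun w hw => (hin w (by simpa using hw)).le)
      simpa [isClosed_Iic.closure_eq] using this
    obtain ⟨k, hk, hkz⟩ := aux_jack (fun z => p z ^ 2 - 1) hωd (by simp [h0]) z hz hz0 heq hin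
    have hpd : HasDerivAt p (deriv p z) z :=
      ((hd z hz).differentiableAt (isOpen_ball.mem_nhds hz)).hasDerivAt
    have hder : deriv (fun z => p z ^ 2 - 1) z = 2 * p z * deriv p z := by
      have := ((hpd.pow 2).sub_const 1).deriv
      simpa using this
    rw [hder] at hkz
    have hpz := hne z hz
    have hkz' : z * deriv p z / p z = k / 2 * ((p z ^ 2 - 1) / p z ^ 2) := by
      field_simp
      linear_combination hkz
    have hhalf : ((p z ^ 2 - 1) / p z ^ 2).re = 1 / 2 := by
      have hq : p z ^ 2 ≠ 0 := pow_ne_zero _ hpz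
      generalize p z ^ 2 = q at heq hq
      have hn : Complex.normSq q ≠ 0 := by simpa using hq
      have h2 : Complex.normSq (q - 1) = 1 := by rw [Complex.normSq_eq_norm_sq, heq]; norm_num
      rw [Complex.normSq_apply] at h2 hn
      simp at h2
      rw [Complex.div_re, Complex.normSq_apply]
      rw [← add_div, div_eq_iff hn]
      simp
      linear_combination h2 / 2
    have := hre z hz hz0
    rw [hkz', show ((k:ℂ)/2) = ((k/2 : ℝ) : ℂ) by push_cast; rfl, Complex.re_ofReal_mul, hhalf] at this
    linarith
  refine ⟨hlt, ?_⟩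
  have hre0 : ∀ z ∈ ball (0 : ℂ) 1, (p z).re ≠ 0 := by
    intro z hz h
    have h1 := hlt z hz
    have h2 : (p z ^ 2 - 1).re = -(p z).im ^ 2 - 1 := by
      simp [pow_two, h]
    have h3 := (abs_le.mp (Complex.abs_re_le_norm (p z ^ 2 - 1))).1
    rw [h2] at h3
    nlinarith [sq_nonneg (p z).im]
  intro z hz
  by_contra! hcon
  have hpre : IsPreconnected (ball (0:ℂ) 1) := (convex_ball (0:ℂ) 1).isPreconnected
  have hcont : ContinuousOn (fun z => (p z).re) (ball (0:ℂ) 1) :=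
    Complex.continuous_re.comp_continuousOn hd.continuousOn
  have := hpre.intermediate_value hz (mem_ball_self one_pos) hcont
  obtain ⟨w, hw, hw0⟩ := this (show (0:ℝ) ∈ Set.Icc _ _ from ⟨hcon, by simp [h0]⟩)
  exact hre0 w hw hw0

lemma aux_poch (a : ℝ) (k : ℕ) : a * poch (a + 1) k = (a + k) * poch a k := by
  have h1 : poch a (k + 1) = a * poch (a + 1) k := by
    simp [poch, ascPochhammer_succ_left]
  have h2 : poch a (k + 1) = poch a k * (a + k) := by
    simp [poch, ascPochhammer_succ_right]
  rw [← h1, h2, mul_comm]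

lemma aux_shift (h : ℕ → ℂ) (F : ℂ → ℂ) (h0 : h 0 = 0)
    (hF : ∀ z ∈ ball (0 : ℂ) 1, HasSum (fun k : ℕ => h k * z ^ k) (F z)) :
    ∀ z ∈ ball (0 : ℂ) 1, HasSum (fun k : ℕ => h (k + 1) * z ^ k)
      (if z = 0 then h 1 else F z / z) := by
  intro z hz
  split_ifs with hz0
  · subst hz0
    have := hasSum_single (f := fun k : ℕ => h (k + 1) * (0:ℂ) ^ k) 0 (by
      intro k hk; simp [hk])
    simpa using this
  · have h1 := (hasSum_nat_add_iff' (f := fun k : ℕ => h k * z ^ k) 1).mpr (hF z hz)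
    have h2 := h1.div_const z
    simp [h0] at h2
    have e : (fun k : ℕ => h (k + 1) * z ^ k) = fun k : ℕ => h (k + 1) * z ^ (k + 1) / z := by
      funext k
      rw [pow_succ]; field_simp
    rw [e]
    exact h2

/-- Sufficient condition for membership in `R^c_{a,b}`: if
`Re(I^c_{a+1,b}f / I^c_{a,b}f) < 1 + 1/(4a)` on the punctured unit disk, then
`f ∈ R^c_{a,b}`. Here `F` and `G` denote the Hohlov transforms `I^c_{a,b} f`
and `I^c_{a+1,b} f`, respectively. -/
theorem stmt_15 (a b c : ℝ) (hc : 0 < c) (ha : c ≤ a) (hb : c ≤ b)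
    (coef : ℕ → ℂ) (hA : InClassA coef)
    (F G : ℂ → ℂ)
    (hF : ∀ z ∈ ball (0 : ℂ) 1,
      HasSum (fun k : ℕ => (hohCoef a b c k : ℂ) * coef k * z ^ k) (F z))
    (hG : ∀ z ∈ ball (0 : ℂ) 1,
      HasSum (fun k : ℕ => (hohCoef (a + 1) b c k : ℂ) * coef k * z ^ k) (G z))
    (hne : ∀ z ∈ ball (0 : ℂ) 1, z ≠ 0 → F z ≠ 0)
    (hre : ∀ z ∈ ball (0 : ℂ) 1, z ≠ 0 → (G z / F z).re < 1 + 1 / (4 * a)) :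
    InClassR a b c coef := by
  have ha0 : 0 < a := hc.trans_le ha
  have haC : (a : ℂ) ≠ 0 := by exact_mod_cast ha0.ne'
  set u : ℕ → ℂ := fun k => (hohCoef a b c k : ℂ) * coef k with hu
  set v : ℕ → ℂ := fun k => (hohCoef (a + 1) b c k : ℂ) * coef k with hv
  have hu0 : u 0 = 0 := by simp [hu, hA.1]
  have hv0 : v 0 = 0 := by simp [hv, hA.1]
  have hu1 : u 1 = 1 := by simp [hu, hA.2.1, hohCoef, poch]
  have hrel : ∀ k : ℕ, (a : ℂ) * v (k + 1) = (a + k) * u (k + 1) := by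
    intro k
    have h1 : a * hohCoef (a + 1) b c (k + 1) = (a + k) * hohCoef a b c (k + 1) := by
      simp only [hohCoef, Nat.add_sub_cancel]
      rw [← mul_div_assoc, ← mul_div_assoc, ← mul_assoc, ← mul_assoc, aux_poch]
    have h2 : (a : ℂ) * (hohCoef (a + 1) b c (k + 1) : ℂ) = (a + k) * (hohCoef a b c (k + 1) : ℂ) := by
      exact_mod_cast h1
    simp only [hu, hv]
    linear_combination coef (k + 1) * h2
  have hp := aux_shift u F hu0 hF
  have hg := aux_shift v G hv0 hG
  set p : ℂ → ℂ := fun z => if z = 0 then u 1 else F z / z with hpdef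
  obtain ⟨hd, hder⟩ := aux_ps (fun k => u (k + 1)) p hp
  have hp0 : p 0 = 1 := by simp [hpdef, hu1]
  have hpz : ∀ z, z ≠ 0 → p z = F z / z := by intro z hz; simp [hpdef, hz]
  have hpne : ∀ z ∈ ball (0 : ℂ) 1, p z ≠ 0 := by
    intro z hz
    by_cases h : z = 0
    · rw [h, hp0]; exact one_ne_zero
    · rw [hpz z h]; exact div_ne_zero (hne z hz h) h
  have hcore := aux_core p hd hp0 hpne (by
    intro z hz hz0
    have e1 := hg z hz
    rw [if_neg hz0] at e1
    have e2 := ((hp z hz).mul_left (a : ℂ)).add (hder z hz)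
    have e3 := e1.mul_left (a : ℂ)
    have e4 : (a : ℂ) * (G z / z) = a * p z + z * deriv p z := by
      refine e3.unique ?_
      convert e2 using 1
      funext k
      linear_combination z ^ k * hrel k
    have hFz := hne z hz hz0
    have hpF : F z = z * p z := by rw [hpz z hz0]; field_simp
    have hpn := hpne z hz
    have e5 : z * deriv p z / p z = (a : ℂ) * (G z / F z - 1) := by
      rw [hpF]
      field_simp
      field_simp at e4
      linear_combination -e4
    rw [e5, Complex.re_ofReal_mul]
    have h := hre z hz hz0
    have h' : (G z / F z - 1).re < 1 / (4 * a) := by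
      rw [Complex.sub_re, Complex.one_re]; linarith
    calc a * (G z / F z - 1).re < a * (1 / (4 * a)) := by gcongr
      _ = 1 / 4 := by field_simp)
  refine ⟨hA, fun z => p z ^ 2 - 1, ?_, by simp [hp0], hcore.1, ?_⟩
  · have : DifferentiableOn ℂ (fun z => p z ^ 2 - 1) (ball (0:ℂ) 1) := by fun_prop
    exact (this.analyticOnNhd isOpen_ball).analyticOn
  · intro z hz
    have hpos := hcore.2 z hz
    have hsq : (1 + (p z ^ 2 - 1)) ^ ((1 : ℂ) / 2) = p z := by
      rw [add_sub_cancel, one_div]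
      exact Complex.sq_cpow_two_inv hpos
    rw [hsq]
    have hzp : z * p z = F z := by
      by_cases h : z = 0
      · subst h
        have := (hF 0 hz).unique (hasSum_single (f := fun k : ℕ => u k * (0:ℂ) ^ k) 0 (by
          intro k hk; simp [hk]))
        simp [this, hu0]
      · rw [hpz z h]; field_simp
    rw [hzp]
    exact hF z hz
end
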